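/- Let R be an order in an étale ℚ-algebra K and let I and J be fractional R-ideals, with trace duals I^t and J^t. Then I and J are isomorphic as R-modules if and only if I^t and J^t are isomorphic as R-modules; and I and J are weakly equivalent (1 ∈ (I:J)(J:I)) if and only if I^t and J^t are weakly equivalent. -/

import Mathlib

/-!
Setting: `K` is an étale `ℚ`-algebra (a commutative `ℚ`-algebra, reduced and
finite-dimensional over `ℚ`), and `R` is an order in `K`: a subring of `K`
(equivalently a `ℤ`-subalgebra) that is finitely generated as a `ℤ`-module and
spans `K` over `ℚ`.  A fractional `R`-ideal is a finitely generated
`R`-submodule of `K` spanning `K` over `ℚ`.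
-/

open Submodule

variable {K : Type*} [CommRing K] [Algebra ℚ K]
variable {R : Subalgebra ℤ K}

/-- The ideal quotient `(I : J) = {x ∈ K | x·J ⊆ I}`. -/
def colonSub (I J : Submodule ↥R K) : Submodule ↥R K where
  carrier := {x : K | ∀ y ∈ J, x * y ∈ I}
  zero_mem' := fun y _ => by simp [I.zero_mem]
  add_mem' := fun {a b} ha hb y hy => by
    simpa [add_mul] using I.add_mem (ha y hy) (hb y hy)
  smul_mem' := fun c x hx y hy => by
    simpa [smul_mul_assoc] using I.smul_mem c (hx y hy)

/-- The trace dual `I^t = {x ∈ K | Tr_{K/ℚ}(x·I) ⊆ ℤ}`, where `Tr_{K/ℚ}(z)` is the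
trace of the `ℚ`-linear endomorphism `y ↦ z·y` of `K`. -/
def traceDualSub (I : Submodule ↥R K) : Submodule ↥R K where
  carrier := {x : K | ∀ y ∈ I, ∃ n : ℤ, Algebra.trace ℚ K (x * y) = (n : ℚ)}
  zero_mem' := fun y _ => ⟨0, by simp⟩
  add_mem' := fun {a b} ha hb y hy => by
    obtain ⟨n, hn⟩ := ha y hy
    obtain ⟨m, hm⟩ := hb y hy
    refine ⟨n + m, ?_⟩
    rw [add_mul, map_add, hn, hm]
    push_cast
    ring
  smul_mem' := fun c x hx y hy => by
    obtain ⟨n, hn⟩ := hx (c • y) (I.smul_mem c hy)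
    refine ⟨n, ?_⟩
    rw [← hn]
    congr 1
    rw [Algebra.smul_def, Algebra.smul_def]
    ring

section Helpers

theorem aux_nondeg [FiniteDimensional ℚ K] [IsReduced K] :
    (Algebra.traceForm ℚ K).Nondegenerate := by
  have hs : (Algebra.traceForm ℚ K).IsSymm := Algebra.traceForm_isSymm ℚ
  have key : ∀ x : K, (∀ y, Algebra.trace ℚ K (x * y) = 0) → x = 0 := by
    intro x hx
    have : IsArtinianRing K := IsArtinianRing.of_finite ℚ K
    obtain ⟨n, y, hy⟩ := IsArtinian.exists_pow_succ_smul_dvd x (1 : K)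
    simp only [smul_eq_mul, mul_one] at hy
    have h0 : x * (1 - x * y) = 0 := by
      apply IsReduced.eq_zero
      refine ⟨n + 1, ?_⟩
      have h1 : x ^ n * (1 - x * y) = 0 := by
        have : x ^ n * (1 - x * y) = x ^ n - x ^ (n + 1) * y := by ring
        rw [this, hy, sub_self]
      calc (x * (1 - x * y)) ^ (n + 1)
          = (x ^ n * (1 - x * y)) * (x * (1 - x * y) ^ n) := by rw [mul_pow]; ring
        _ = 0 := by rw [h1, zero_mul]
    have he : IsIdempotentElem (x * y) := by
      change x * y * (x * y) = x * y
      linear_combination (-y) * h0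
    have he' : IsIdempotentElem (LinearMap.mulLeft ℚ (x * y)) := by
      change _ * _ = _
      ext z
      change x * y * (x * y * z) = x * y * z
      rw [← mul_assoc, he.eq]
    have ht : LinearMap.trace ℚ K (LinearMap.mulLeft ℚ (x * y)) = 0 := hx y
    have hz := (LinearMap.IsIdempotentElem.trace_eq_zero_iff he').1 ht
    have hxy : x * y = 0 := by
      have := LinearMap.congr_fun hz 1
      simpa using this
    have : x = x * y * x := by linear_combination h0
    rw [this, hxy, zero_mul]
  refine ⟨fun x hx => key x hx, fun x hx => key x fun y => ?_⟩
  rw [mul_comm]; exact hx y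

theorem aux_basis [FiniteDimensional ℚ K]
    (hRfin : Module.Finite ℤ R) (I : Submodule ↥R K)
    (hIfg : I.FG) (hIspan : Submodule.span ℚ (I : Set K) = ⊤) :
    ∃ (ι : Type) (_ : Finite ι) (b : Module.Basis ι ℚ K),
      ∀ x, x ∈ I ↔ x ∈ Submodule.span ℤ (Set.range b) := by
  have hfg : (I.restrictScalars ℤ).FG := by
    have : Module.Finite R I := Module.Finite.iff_fg.2 hIfg
    have h2 : Module.Finite ℤ I := Module.Finite.trans R I
    exact Module.Finite.iff_fg.1 (show Module.Finite ℤ (I.restrictScalars ℤ) from h2)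
  have hl : IsLattice ℚ (I.restrictScalars ℤ) := ⟨hfg, hIspan⟩
  have hfree : Module.Free ℤ (I.restrictScalars ℤ) := IsLattice.free ℚ _
  let b0 := Module.finBasis ℤ (I.restrictScalars ℤ)
  refine ⟨_, inferInstance, b0.extendOfIsLattice ℚ, fun x => ?_⟩
  have hr : Set.range (b0.extendOfIsLattice ℚ) =
      (I.restrictScalars ℤ).subtype '' Set.range b0 := by
    rw [← Set.range_comp]
    congr 1
    funext k
    simp
  rw [hr, Submodule.span_image, b0.span_eq, Submodule.map_top, Submodule.range_subtype]
  rfl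

theorem aux_mem_dual (I : Submodule ↥R K) (N : Submodule ℤ K) (h : ∀ x, x ∈ I ↔ x ∈ N) (x : K) :
    x ∈ traceDualSub I ↔ x ∈ (Algebra.traceForm ℚ K).dualSubmodule N := by
  change (∀ y ∈ I, ∃ n : ℤ, Algebra.trace ℚ K (x * y) = (n : ℚ)) ↔ ∀ y ∈ N, _
  simp only [h, Submodule.mem_one, Algebra.traceForm_apply]
  refine forall₂_congr fun y _ => exists_congr fun n => ?_
  simp [eq_comm]

theorem aux_dd [FiniteDimensional ℚ K] [IsReduced K]
    (hRfin : Module.Finite ℤ R) (I : Submodule ↥R K)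
    (hIfg : I.FG) (hIspan : Submodule.span ℚ (I : Set K) = ⊤) :
    traceDualSub (traceDualSub I) = I ∧
      Submodule.span ℚ (traceDualSub I : Set K) = ⊤ := by
  classical
  obtain ⟨ι, _, b, hb⟩ := aux_basis hRfin I hIfg hIspan
  constructor
  · ext x
    rw [aux_mem_dual _ _ (aux_mem_dual I _ hb), hb,
      LinearMap.BilinForm.dualSubmodule_dualSubmodule_of_basis _ aux_nondeg
        (Algebra.traceForm_isSymm ℚ)]
  · rw [eq_top_iff, ← ((Algebra.traceForm ℚ K).dualBasis aux_nondeg b).span_eq]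
    apply Submodule.span_mono
    intro x hx
    rw [SetLike.mem_coe, aux_mem_dual I _ hb,
      LinearMap.BilinForm.dualSubmodule_span_of_basis _ aux_nondeg]
    exact Submodule.subset_span hx

theorem aux_int (I : Submodule ↥R K) (hIspan : Submodule.span ℚ (I : Set K) = ⊤) (x : K) :
    ∃ n : ℤ, n ≠ 0 ∧ (n : K) * x ∈ I := by
  have hx : x ∈ Submodule.span ℚ (I : Set K) := by rw [hIspan]; trivial
  induction hx using Submodule.span_induction with
  | mem x h => exact ⟨1, one_ne_zero, by simpa using h⟩
  | zero => exact ⟨1, one_ne_zero, by simp⟩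
  | add x y _ _ hx hy =>
    obtain ⟨n, hn, hx⟩ := hx
    obtain ⟨m, hm, hy⟩ := hy
    refine ⟨n * m, mul_ne_zero hn hm, ?_⟩
    have := I.add_mem (I.smul_mem (m : R) hx) (I.smul_mem (n : R) hy)
    rw [Algebra.smul_def, Algebra.smul_def, map_intCast, map_intCast] at this
    convert this using 1
    push_cast; ring
  | smul q x _ hx =>
    obtain ⟨n, hn, hx⟩ := hx
    refine ⟨n * q.den, mul_ne_zero hn (by exact_mod_cast q.den_nz), ?_⟩
    have := I.smul_mem (q.num : R) hx
    rw [Algebra.smul_def, map_intCast] at this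
    convert this using 1
    have hq : (q.den : K) * algebraMap ℚ K q = q.num := by
      rw [← map_natCast (algebraMap ℚ K), ← map_mul, mul_comm, Rat.mul_den_eq_num, map_intCast]
    rw [Algebra.smul_def]
    push_cast
    linear_combination (n * x : K) * hq

theorem aux_cancel {n : ℤ} (hn : n ≠ 0) {x y : K} (h : (n : K) * x = n * y) : x = y := by
  have hu : IsUnit (n : K) := by
    have : IsUnit (n : ℚ) := (Int.cast_ne_zero.2 hn).isUnit
    simpa using this.map (algebraMap ℚ K)
  exact hu.mul_left_cancel h

theorem aux_mul (hRspan : Submodule.span ℚ (R : Set K) = ⊤)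
    (I J : Submodule ↥R K) (hIspan : Submodule.span ℚ (I : Set K) = ⊤)
    (f : I →ₗ[R] J) : ∃ u : K, ∀ x : I, (f x : K) = u * x := by
  obtain ⟨N, hN, hNI⟩ := aux_int I hIspan 1
  refine ⟨algebraMap ℚ K (N : ℚ)⁻¹ * f ⟨_, hNI⟩, fun x => ?_⟩
  have hinv : (N : K) * algebraMap ℚ K (N : ℚ)⁻¹ = 1 := by
    rw [← map_intCast (algebraMap ℚ K), ← map_mul, mul_inv_cancel₀ (Int.cast_ne_zero.2 hN),
      map_one]
  have hR1 : Submodule.span ℚ (((1 : Submodule R K)) : Set K) = ⊤ := by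
    rw [← hRspan]
    congr 1
    ext z
    simp [Submodule.mem_one]
  obtain ⟨m, hm, hmx⟩ := aux_int (1 : Submodule R K) hR1 x
  obtain ⟨r, hr⟩ := Submodule.mem_one.1 hmx
  have e : r • (⟨_, hNI⟩ : I) = ((m * N : ℤ) : R) • x := by
    ext
    simp only [Submodule.coe_smul, Algebra.smul_def, hr, map_intCast]
    push_cast; ring
  have e2 := congrArg (fun z => (f z : K)) e
  simp only [map_smul, Submodule.coe_smul, Algebra.smul_def, hr, map_intCast] at e2
  apply aux_cancel (mul_ne_zero hm hN)
  rw [← e2]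
  push_cast
  linear_combination (-(m * x * f ⟨_, hNI⟩ : K)) * hinv

theorem aux_fwd (hRspan : Submodule.span ℚ (R : Set K) = ⊤)
    (I J : Submodule ↥R K) (hIspan : Submodule.span ℚ (I : Set K) = ⊤)
    (hJspan : Submodule.span ℚ (J : Set K) = ⊤)
    (h : Nonempty (I ≃ₗ[R] J)) :
    Nonempty (traceDualSub I ≃ₗ[R] traceDualSub J) := by
  obtain ⟨f⟩ := h
  obtain ⟨u, hu⟩ := aux_mul hRspan I J hIspan f.toLinearMap
  obtain ⟨v, hv⟩ := aux_mul hRspan J I hJspan f.symm.toLinearMap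
  simp only [LinearEquiv.coe_coe] at hu hv
  have huv : v * u = 1 := by
    obtain ⟨N, hN, hNI⟩ := aux_int I hIspan 1
    apply aux_cancel hN
    have := hv (f ⟨_, hNI⟩)
    rw [hu, LinearEquiv.symm_apply_apply] at this
    change (N : K) * 1 = v * (u * (N * 1)) at this
    rw [this]; ring
  have h1 : ∀ x ∈ traceDualSub I, v * x ∈ traceDualSub J := by
    intro x hx y hy
    obtain ⟨n, hn⟩ := hx _ (f.symm ⟨y, hy⟩).2
    refine ⟨n, ?_⟩
    rw [← hn, hv]
    congr 1; ring
  have h2 : ∀ x ∈ traceDualSub J, u * x ∈ traceDualSub I := by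
    intro x hx y hy
    obtain ⟨n, hn⟩ := hx _ (f ⟨y, hy⟩).2
    refine ⟨n, ?_⟩
    rw [← hn, hu]
    congr 1; ring
  refine ⟨{ toFun := fun x => ⟨v * x, h1 x x.2⟩
            invFun := fun x => ⟨u * x, h2 x x.2⟩
            map_add' := ?_
            map_smul' := ?_
            left_inv := ?_
            right_inv := ?_ }⟩
  · intro x y; ext; simp [mul_add]
  · intro r x; ext; simp
  · intro x; ext
    change u * (v * x) = (x : K)
    linear_combination (x : K) * huv
  · intro x; ext
    change v * (u * x) = (x : K)
    linear_combination (x : K) * huv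

theorem aux_colon (I J : Submodule ↥R K) :
    colonSub I J ≤ colonSub (traceDualSub J) (traceDualSub I) := by
  intro x hx y hy z hz
  obtain ⟨n, hn⟩ := hy _ (hx z hz)
  refine ⟨n, ?_⟩
  rw [← hn]
  congr 1; ring

end Helpers

/-- Let `R` be an order in an étale `ℚ`-algebra `K` and `I`, `J`
fractional `R`-ideals, with trace duals `I^t`, `J^t`.  Then `I ≅ J` as `R`-modules if
and only if `I^t ≅ J^t` as `R`-modules; and `I` and `J` are weakly equivalent
(`1 ∈ (I:J)(J:I)`) if and only if `I^t` and `J^t` are weakly equivalent. -/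
theorem iso_and_weak_equivalence_of_traceDuals
    [FiniteDimensional ℚ K] [IsReduced K]
    (hRfin : Module.Finite ℤ R) (hRspan : Submodule.span ℚ (R : Set K) = ⊤)
    (I J : Submodule ↥R K)
    (hIfg : I.FG) (hIspan : Submodule.span ℚ (I : Set K) = ⊤)
    (hJfg : J.FG) (hJspan : Submodule.span ℚ (J : Set K) = ⊤) :
    (Nonempty (↥I ≃ₗ[↥R] ↥J) ↔
        Nonempty (↥(traceDualSub I) ≃ₗ[↥R] ↥(traceDualSub J))) ∧
      ((1 : K) ∈ colonSub I J * colonSub J I ↔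
        (1 : K) ∈ colonSub (traceDualSub I) (traceDualSub J) *
          colonSub (traceDualSub J) (traceDualSub I)) := by
  obtain ⟨hI, hIs⟩ := aux_dd hRfin I hIfg hIspan
  obtain ⟨hJ, hJs⟩ := aux_dd hRfin J hJfg hJspan
  have hc : ∀ A B : Submodule R K, traceDualSub (traceDualSub A) = A →
      traceDualSub (traceDualSub B) = B →
      colonSub (traceDualSub B) (traceDualSub A) = colonSub A B := by
    intro A B hA hB
    apply le_antisymm _ (aux_colon A B)
    have := aux_colon (traceDualSub B) (traceDualSub A)
    rwa [hA, hB] at this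
  constructor
  · refine ⟨aux_fwd hRspan I J hIspan hJspan, fun h => ?_⟩
    have := aux_fwd hRspan _ _ hIs hJs h
    rwa [hI, hJ] at this
  · rw [hc I J hI hJ, hc J I hJ hI, mul_comm]
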